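/- arXiv:1310.3552 — 5 statements merged into one kernel-verified Lean document; each statement's English description precedes it below -/
import Mathlib

section
/- Let I be the radical ideal of r distinct points of K^n (n ≥ 1) and let γ(I) = lim_{m→∞} α(I^m)/m (which exists). Then: γ(I) = 1 if n = 2 and r ∈ {1,2}; γ(I) ≤ 3/2 if n = 2 and r = 3; γ(I) ≤ 2 if n = 2 and r ∈ {4,5}; γ(I) ≤ 12/5 if n = 2 and r = 6; γ(I) ≤ 21/8 if n = 2 and r = 7; and γ(I) ≤ 48/17 if n = 2 and r = 8. -/
open MvPolynomial Filter
open scoped Classical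

noncomputable section

/-- The (maximal) ideal of polynomials vanishing at the point `p` of affine `n`-space. -/
def pointIdeal {n : ℕ} (K : Type*) [Field K] (p : Fin n → K) :
    Ideal (MvPolynomial (Fin n) K) :=
  RingHom.ker (MvPolynomial.eval p)

/-- The homogeneous ideal generated by the forms vanishing at (a representative of) a point of
projective space. -/
def projPointIdeal {N : ℕ} (K : Type*) [Field K] (p : Fin N → K) :
    Ideal (MvPolynomial (Fin N) K) :=
  Ideal.span { f | (∃ d, f.IsHomogeneous d) ∧ MvPolynomial.eval p f = 0 }

/-- `α(I)`: the least degree of a nonzero element of `I`. -/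
def alphaDeg {σ K : Type*} [Field K] (I : Ideal (MvPolynomial σ K)) : ℕ :=
  sInf { d | ∃ f ∈ I, f ≠ 0 ∧ f.totalDegree = d }

/-- `H^≤_I(t) = dim_K I_{≤ t}`. -/
def hilbLe {n : ℕ} (K : Type*) [Field K] (I : Ideal (MvPolynomial (Fin n) K)) (t : ℕ) : ℕ :=
  Module.finrank K
    ↥(Submodule.restrictScalars K I ⊓ MvPolynomial.restrictTotalDegree (Fin n) K t)

/-- `H_{R/I}(t) = dim_K R_t/I_t = dim_K R_t - dim_K I_t`. -/
def hilbProj {N : ℕ} (K : Type*) [Field K] (I : Ideal (MvPolynomial (Fin N) K)) (t : ℕ) : ℕ :=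
  Module.finrank K ↥(MvPolynomial.homogeneousSubmodule (Fin N) K t) -
    Module.finrank K
      ↥(Submodule.restrictScalars K I ⊓ MvPolynomial.homogeneousSubmodule (Fin N) K t)

/-- The substitution `X i ↦ X i + p i`, moving the point `p` to the origin. -/
def translateHom {σ K : Type*} [Field K] (p : σ → K) : MvPolynomial σ K →ₐ[K] MvPolynomial σ K :=
  aeval fun i => X i + C (p i)

lemma translateHom_neg_translateHom {σ K : Type*} [Field K] (p : σ → K) (f : MvPolynomial σ K) :
    translateHom (-p) (translateHom p f) = f := by
  have h : (translateHom (-p)).comp (translateHom p) = AlgHom.id K (MvPolynomial σ K) := by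
    ext i : 1
    simp [translateHom]
  exact DFunLike.congr_fun h f

lemma translateHom_injective {σ K : Type*} [Field K] (p : σ → K) :
    Function.Injective (translateHom p) :=
  Function.LeftInverse.injective (translateHom_neg_translateHom p)

lemma totalDegree_translateHom_le {σ K : Type*} [Field K] (p : σ → K) (f : MvPolynomial σ K) :
    (translateHom p f).totalDegree ≤ f.totalDegree := by
  have hX (i : σ) : (X i + C (p i)).totalDegree ≤ 1 :=
    (totalDegree_add _ _).trans (by simp)
  rw [translateHom, aeval_def, eval₂_eq]
  refine totalDegree_finsetSum_le fun s hs => ?_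
  calc (algebraMap K (MvPolynomial σ K) (coeff s f) *
        ∏ i ∈ s.support, (X i + C (p i)) ^ s i).totalDegree
      ≤ 0 + ∑ i ∈ s.support, s i := by
        refine (totalDegree_mul _ _).trans (add_le_add (by simp [algebraMap_eq]) ?_)
        refine (totalDegree_finsetProd _ _).trans (Finset.sum_le_sum fun i _ => ?_)
        exact (totalDegree_pow _ _).trans (by simpa using Nat.mul_le_mul_left (s i) (hX i))
    _ ≤ f.totalDegree := by simpa [Finsupp.sum] using le_totalDegree hs

lemma mem_pointIdeal_iff_translateHom {n : ℕ} {K : Type*} [Field K] (p : Fin n → K)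
    (f : MvPolynomial (Fin n) K) :
    f ∈ pointIdeal K p ↔ translateHom p f ∈ idealOfVars (Fin n) K := by
  have h : constantCoeff (translateHom p f) = eval p f := by
    have : (constantCoeff.comp (translateHom p).toRingHom) = eval p := by
      ext i <;> simp [translateHom]
    exact DFunLike.congr_fun this f
  rw [pointIdeal, RingHom.mem_ker, ← h, ← pow_one (idealOfVars (Fin n) K),
    mem_pow_idealOfVars_iff']
  simp [Finsupp.degree_eq_zero_iff, constantCoeff_eq]

lemma mem_pointIdeal_pow_iff {n : ℕ} {K : Type*} [Field K] (p : Fin n → K) (k : ℕ)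
    (f : MvPolynomial (Fin n) K) :
    f ∈ pointIdeal K p ^ k ↔ ∀ x : Fin n →₀ ℕ, x.degree < k → (translateHom p f).coeff x = 0 := by
  rw [← mem_pow_idealOfVars_iff']
  constructor
  · intro hf
    have hle : (pointIdeal K p).map (translateHom p) ≤ idealOfVars (Fin n) K :=
      Ideal.map_le_iff_le_comap.2 fun g hg => (mem_pointIdeal_iff_translateHom p g).1 hg
    have := Ideal.mem_map_of_mem (translateHom p) hf
    rw [Ideal.map_pow] at this
    exact Ideal.pow_right_mono hle k this
  · intro hf
    have hle : (idealOfVars (Fin n) K).map (translateHom (-p)) ≤ pointIdeal K p :=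
      Ideal.map_le_iff_le_comap.2 fun g hg => by
        rw [Ideal.mem_comap, mem_pointIdeal_iff_translateHom]
        have := translateHom_neg_translateHom (-p) g
        rw [neg_neg] at this
        rwa [this]
    have := Ideal.mem_map_of_mem (translateHom (-p)) hf
    rw [Ideal.map_pow, translateHom_neg_translateHom] at this
    exact Ideal.pow_right_mono hle k this

lemma le_totalDegree_of_mem_pointIdeal_pow {n : ℕ} {K : Type*} [Field K] {p : Fin n → K} {k : ℕ}
    {f : MvPolynomial (Fin n) K} (hf : f ∈ pointIdeal K p ^ k) (h0 : f ≠ 0) :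
    k ≤ f.totalDegree := by
  by_contra! hlt
  refine h0 (translateHom_injective p ?_)
  rw [map_zero]
  ext x
  rw [coeff_zero]
  by_cases hx : x.degree < k
  · exact (mem_pointIdeal_pow_iff p k f).1 hf x hx
  · refine coeff_eq_zero_of_totalDegree_lt ?_
    rw [← Finsupp.degree_apply]
    exact (totalDegree_translateHom_le p f).trans_lt (by omega)

instance isMaximal_pointIdeal {n : ℕ} {K : Type*} [Field K] (p : Fin n → K) :
    (pointIdeal K p).IsMaximal :=
  RingHom.ker_isMaximal_of_surjective _ fun a => ⟨C a, eval_C a⟩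

lemma pointIdeal_injective {n : ℕ} {K : Type*} [Field K] :
    Function.Injective (pointIdeal K : (Fin n → K) → Ideal (MvPolynomial (Fin n) K)) := by
  intro p q h
  ext j
  have : (X j - C (q j) : MvPolynomial (Fin n) K) ∈ pointIdeal K p := by
    rw [h]
    simp [pointIdeal, RingHom.mem_ker]
  simpa [pointIdeal, RingHom.mem_ker, sub_eq_zero] using this

lemma iInf_pointIdeal_pow {n r : ℕ} {K : Type*} [Field K] {p : Fin r → Fin n → K}
    (hp : Function.Injective p) (m : ℕ) :
    (⨅ i, pointIdeal K (p i)) ^ m = ⨅ i, pointIdeal K (p i) ^ m := by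
  have hco : Pairwise (Function.onFun IsCoprime fun i => pointIdeal K (p i)) := fun i j hij =>
    Ideal.isCoprime_of_isMaximal fun h => hij (hp (pointIdeal_injective h))
  have h1 := Ideal.prod_eq_iInf_of_pairwise_isCoprime (s := Finset.univ) (hco.set_pairwise _)
  have h2 := Ideal.prod_eq_iInf_of_pairwise_isCoprime (s := Finset.univ)
    (J := fun i => pointIdeal K (p i) ^ m) fun i _ j _ hij => (hco hij).pow
  simp only [Finset.mem_univ, iInf_pos] at h1 h2
  rw [← h1, ← h2, Finset.prod_pow]

lemma iInf_pointIdeal_ne_bot {n r : ℕ} [NeZero n] {K : Type*} [Field K]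
    (p : Fin r → Fin n → K) : (⨅ i, pointIdeal K (p i)) ≠ ⊥ := by
  intro hbot
  have hmem : ∏ i, (X 0 - C (p i 0) : MvPolynomial (Fin n) K) ∈ ⨅ i, pointIdeal K (p i) :=
    Ideal.mem_iInf.2 fun i => Ideal.mem_of_dvd _
      (Finset.dvd_prod_of_mem (fun i => X 0 - C (p i 0)) (Finset.mem_univ i))
      (RingHom.mem_ker.2 (by simp))
  rw [hbot, Ideal.mem_bot] at hmem
  obtain ⟨i, -, hi⟩ := Finset.prod_eq_zero_iff.1 hmem
  have h1 : (0 : Fin n →₀ ℕ) ≠ Finsupp.single 0 1 := fun h =>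
    one_ne_zero (Finsupp.single_eq_zero.1 h.symm)
  simpa [coeff_C, h1] using congrArg (coeff (Finsupp.single 0 1)) hi

lemma alphaDeg_le {σ K : Type*} [Field K] {I : Ideal (MvPolynomial σ K)} {f : MvPolynomial σ K}
    (hf : f ∈ I) (h0 : f ≠ 0) : alphaDeg I ≤ f.totalDegree :=
  Nat.sInf_le ⟨f, hf, h0, rfl⟩

lemma exists_totalDegree_eq_alphaDeg {σ K : Type*} [Field K] {I : Ideal (MvPolynomial σ K)}
    (hI : I ≠ ⊥) : ∃ f ∈ I, f ≠ 0 ∧ f.totalDegree = alphaDeg I := by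
  obtain ⟨f, hf, h0⟩ := (Submodule.ne_bot_iff _).1 hI
  exact Nat.sInf_mem (s := {d | ∃ f ∈ I, f ≠ 0 ∧ f.totalDegree = d}) ⟨_, f, hf, h0, rfl⟩

lemma subadditive_alphaDeg_pow {σ K : Type*} [Field K] {I : Ideal (MvPolynomial σ K)}
    (hI : I ≠ ⊥) : Subadditive fun m => (alphaDeg (I ^ m) : ℝ) := by
  intro a b
  obtain ⟨f, hf, hf0, hfd⟩ := exists_totalDegree_eq_alphaDeg (pow_ne_zero a hI)
  obtain ⟨g, hg, hg0, hgd⟩ := exists_totalDegree_eq_alphaDeg (pow_ne_zero b hI)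
  have h : alphaDeg (I ^ (a + b)) ≤ alphaDeg (I ^ a) + alphaDeg (I ^ b) := by
    rw [← hfd, ← hgd]
    refine (alphaDeg_le ?_ (mul_ne_zero hf0 hg0)).trans (totalDegree_mul f g)
    rw [pow_add]
    exact Ideal.mul_mem_mul hf hg
  beta_reduce
  exact_mod_cast h

lemma card_degree_lt_fin_two (k : ℕ) :
    (Finsupp.finite_of_degree_lt (σ := Fin 2) k).toFinset.card = (k + 1).choose 2 := by
  have h : (Finsupp.finite_of_degree_lt (σ := Fin 2) k).toFinset =
      (Finset.range k).biUnion fun d => Finset.finsuppAntidiag Finset.univ d := by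
    ext x
    simp [Finset.mem_finsuppAntidiag, Finsupp.degree_eq_sum]
  rw [h, Finset.card_biUnion]
  · simp only [Finset.card_finsuppAntidiag_nat_eq_choose]
    simp only [Finset.card_univ, Fintype.card_fin]
    clear h
    induction k with
    | zero => rfl
    | succ k ih =>
      have h2 : 2 + k - 1 = k + 1 := by omega
      rw [Finset.sum_range_succ, ih, h2, Nat.choose_succ_self_right, Nat.choose_succ_succ' (k + 1) 1,
        Nat.choose_one_right, add_comm]
  · intro a _ b _ hab
    refine Finset.disjoint_left.2 fun x hx hx' => hab ?_
    rw [Finset.mem_finsuppAntidiag] at hx hx'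
    exact hx.1.symm.trans hx'.1

/-- Plane curves of degree at most `d` with prescribed multiplicities exist as soon as the number
of conditions is smaller than the number of coefficients. -/
lemma exists_mem_pointIdeal_pow {r : ℕ} {K : Type*} [Field K] (p : Fin r → Fin 2 → K)
    (m : Fin r → ℕ) (d : ℕ) (h : ∑ i, (m i + 1).choose 2 < (d + 2).choose 2) :
    ∃ f : MvPolynomial (Fin 2) K,
      f ≠ 0 ∧ f.totalDegree ≤ d ∧ ∀ i, f ∈ pointIdeal K (p i) ^ m i := by
  let S (k : ℕ) : Finset (Fin 2 →₀ ℕ) := (Finsupp.finite_of_degree_lt k).toFinset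
  let V := restrictSupport K (S (d + 1) : Set (Fin 2 →₀ ℕ))
  let L : V →ₗ[K] ((Σ i, S (m i)) → K) :=
    LinearMap.pi fun x => lcoeff K x.2.1 ∘ₗ (translateHom (p x.1)).toLinearMap ∘ₗ V.subtype
  let B := basisRestrictSupport K (S (d + 1) : Set (Fin 2 →₀ ℕ))
  have : Module.Finite K V := Module.Finite.of_basis B
  have hlt : Module.finrank K ((Σ i, S (m i)) → K) < Module.finrank K V := by
    rw [Module.finrank_eq_card_basis B, Module.finrank_fintype_fun_eq_card]
    simp only [Fintype.card_sigma, Fintype.card_coe, Finset.coe_sort_coe, S,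
      card_degree_lt_fin_two]
    exact h
  obtain ⟨f, hf, hf0⟩ := (Submodule.ne_bot_iff _).1 (L.ker_ne_bot_of_finrank_lt hlt)
  refine ⟨f, by simpa using hf0, ?_, fun i => ?_⟩
  · rw [totalDegree_eq]
    refine Finset.sup_le fun s hs => ?_
    have := ((mem_restrictSupport_iff K).1 f.2) hs
    simpa [S, Finsupp.card_toMultiset, Finsupp.degree_apply, Finsupp.sum,
      Nat.lt_succ_iff] using this
  · refine (mem_pointIdeal_pow_iff _ _ _).2 fun x hx => ?_
    exact congrFun hf ⟨i, x, by simpa [S] using hx⟩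

/-- Multiplying, over all `i`, curves of degree `d` having multiplicity `a` at the `i`-th point
and `b` at the others bounds `α` of a power of the ideal of `s + 1` points of the plane. -/
lemma alphaDeg_pow_le {s : ℕ} {K : Type*} [Field K] {p : Fin (s + 1) → Fin 2 → K}
    (hp : Function.Injective p) (a b d : ℕ)
    (h : (a + 1).choose 2 + s * (b + 1).choose 2 < (d + 2).choose 2) :
    alphaDeg ((⨅ i, pointIdeal K (p i)) ^ (a + s * b)) ≤ (s + 1) * d := by
  let m (i j : Fin (s + 1)) : ℕ := if j = i then a else b
  have hm (g : ℕ → ℕ) (i : Fin (s + 1)) : ∑ j, g (m i j) = g a + s * g b := by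
    rw [← Finset.add_sum_erase _ _ (Finset.mem_univ i),
      Finset.sum_congr rfl (g := fun _ => g b) fun j hj => by simp [m, Finset.ne_of_mem_erase hj]]
    simp [m]
  choose f hf0 hfd hf using fun i =>
    exists_mem_pointIdeal_pow p (m i) d (by rw [hm fun k => (k + 1).choose 2]; exact h)
  refine (alphaDeg_le (f := ∏ i, f i) ?_ (Finset.prod_ne_zero_iff.2 fun i _ => hf0 i)).trans ?_
  · rw [iInf_pointIdeal_pow hp]
    refine Ideal.mem_iInf.2 fun j => ?_
    have : ∑ i, m i j = a + s * b := by
      refine Eq.trans ?_ (hm id j)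
      exact Finset.sum_congr rfl fun i _ => by simp [m, eq_comm]
    rw [← this, ← Finset.prod_pow_eq_pow_sum]
    exact Ideal.prod_mem_prod fun i _ => hf i j
  · refine (totalDegree_finsetProd _ _).trans ((Finset.sum_le_sum fun i _ => hfd i).trans ?_)
    simp

/-- the Waldschmidt constant `γ(I) = lim α(I^m)/m` of the radical ideal of
`r` distinct points of `K^n` exists, equals `1` for `n = 2`, `r ∈ {1,2}`, and satisfies the
stated upper bounds for `n = 2` and `3 ≤ r ≤ 8`. -/
theorem stmt_1 {K : Type*} [Field K] [IsAlgClosed K]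
    (n r : ℕ) (hn : 1 ≤ n)
    (p : Fin r → (Fin n → K)) (hp : Function.Injective p)
    (I : Ideal (MvPolynomial (Fin n) K)) (hI : I = ⨅ i, pointIdeal K (p i)) :
    ∃ γ : ℝ,
      Filter.Tendsto (fun m : ℕ => (alphaDeg (I ^ m) : ℝ) / m) Filter.atTop (nhds γ) ∧
      ((n = 2 ∧ (r = 1 ∨ r = 2)) → γ = 1) ∧
      ((n = 2 ∧ r = 3) → γ ≤ 3 / 2) ∧
      ((n = 2 ∧ (r = 4 ∨ r = 5)) → γ ≤ 2) ∧
      ((n = 2 ∧ r = 6) → γ ≤ 12 / 5) ∧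
      ((n = 2 ∧ r = 7) → γ ≤ 21 / 8) ∧
      ((n = 2 ∧ r = 8) → γ ≤ 48 / 17) := by
  have : NeZero n := ⟨by omega⟩
  have hI0 : I ≠ ⊥ := hI ▸ iInf_pointIdeal_ne_bot p
  have hsub := subadditive_alphaDeg_pow hI0
  have hbdd : BddBelow (Set.range fun m : ℕ => (alphaDeg (I ^ m) : ℝ) / m) :=
    ⟨0, by rintro _ ⟨m, rfl⟩; positivity⟩
  have hlim := hsub.tendsto_lim hbdd
  have key (s a b d : ℕ) (hn2 : n = 2) (hr : r = s + 1)
      (hc : (a + 1).choose 2 + s * (b + 1).choose 2 < (d + 2).choose 2) (hab : a + s * b ≠ 0) :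
      hsub.lim ≤ ((s + 1) * d : ℕ) / (a + s * b : ℕ) := by
    subst hn2 hr hI
    refine (hsub.lim_le_div hbdd hab).trans ?_
    gcongr
    exact alphaDeg_pow_le hp a b d hc
  refine ⟨hsub.lim, hlim, ?_, ?_, ?_, ?_, ?_, ?_⟩
  · rintro ⟨hn2, hr⟩
    apply le_antisymm
    · rcases hr with hr | hr
      · exact (key 0 1 1 1 hn2 hr (by decide) (by decide)).trans (by norm_num)
      · exact (key 1 1 1 1 hn2 hr (by decide) (by decide)).trans (by norm_num)
    · refine ge_of_tendsto hlim ((eventually_ge_atTop 1).mono fun m hm => ?_)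
      rw [one_le_div (by positivity)]
      obtain ⟨f, hf, hf0, hfd⟩ := exists_totalDegree_eq_alphaDeg (pow_ne_zero m hI0)
      have i : Fin r := ⟨0, by omega⟩
      have hle : I ^ m ≤ pointIdeal K (p i) ^ m :=
        Ideal.pow_right_mono (hI ▸ iInf_le _ i) m
      rw [← hfd]
      exact_mod_cast le_totalDegree_of_mem_pointIdeal_pow (hle hf) hf0
  · rintro ⟨hn2, hr⟩
    exact (key 2 0 1 1 hn2 hr (by decide) (by decide)).trans (by norm_num)
  · rintro ⟨hn2, hr | hr⟩
    · exact (key 3 1 1 2 hn2 hr (by decide) (by decide)).trans (by norm_num)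
    · exact (key 4 1 1 2 hn2 hr (by decide) (by decide)).trans (by norm_num)
  · rintro ⟨hn2, hr⟩
    exact (key 5 0 1 2 hn2 hr (by decide) (by decide)).trans (by norm_num)
  · rintro ⟨hn2, hr⟩
    exact (key 6 2 1 3 hn2 hr (by decide) (by decide)).trans (by norm_num)
  · rintro ⟨hn2, hr⟩
    exact (key 7 3 2 6 hn2 hr (by decide) (by decide)).trans (by norm_num)
end
end

section
/- Let p_1,…,p_r be distinct points of K^n, let m_1,…,m_r be positive integers, and let I = ⋂_{i=1}^r I(p_i)^{m_i}. Then for all t ≥ 0, H^≤_I(t) ≥ C(t+n,n) − Σ_{i=1}^r C(m_i+n−1,n), and there exists T such that equality holds for all t ≥ T. -/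
open MvPolynomial Filter
open scoped Classical

noncomputable section

/-- There are `C(t+n,n)` monomials of degree at most `t` in `n` variables. -/
theorem card_degree_le (n t : ℕ) :
    Nat.card {d : Fin n →₀ ℕ | (d.sum fun _ e => e) ≤ t} = (t + n).choose n := by
  have h : {d : Fin n →₀ ℕ | (d.sum fun _ e => e) ≤ t} =
      ↑((Finset.range (t + 1)).biUnion fun k =>
        (Finset.univ : Finset (Fin n)).finsuppAntidiag k) := by
    ext d
    simp [Finset.mem_finsuppAntidiag, Finsupp.sum_fintype]
  rw [h, Nat.card_coe_set_eq, Set.ncard_coe_finset, Finset.card_biUnion,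
    ← Nat.sum_range_multichoose]
  · simp [Finset.card_finsuppAntidiag_nat_eq_multichoose]
  · intro a _ b _ hab
    refine Finset.disjoint_left.2 fun d ha hb => ?_
    rw [Finset.mem_finsuppAntidiag] at ha hb
    exact hab (ha.1.symm.trans hb.1)

theorem finrank_restrictTotalDegree (K : Type*) [Field K] (n t : ℕ) :
    Module.finrank K (restrictTotalDegree (Fin n) K t) = (t + n).choose n :=
  (Module.finrank_eq_nat_card_basis (basisRestrictSupport K _)).trans (card_degree_le n t)

theorem isCompl_pow_idealOfVars_restrictTotalDegree (σ K : Type*) [Field K] (m : ℕ) :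
    IsCompl ((idealOfVars σ K ^ (m + 1)).restrictScalars K) (restrictTotalDegree σ K m) := by
  rw [pow_idealOfVars, restrictScalars_restrictSupportIdeal, isCompl_iff]
  constructor
  · rw [Submodule.disjoint_def]
    intro f hf hf'
    rw [mem_restrictSupport_iff] at hf
    rw [restrictTotalDegree, mem_restrictSupport_iff] at hf'
    rw [← support_eq_empty, Finset.eq_empty_iff_forall_notMem]
    intro d hd
    have h₁ : m + 1 ≤ d.degree := hf hd
    have h₂ : d.degree ≤ m := hf' hd
    omega
  · rw [codisjoint_iff, eq_top_iff, ← restrictSupport_univ, restrictSupport_eq_span,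
      Submodule.span_le]
    rintro _ ⟨d, -, rfl⟩
    rcases le_or_gt d.degree m with h | h
    · exact Submodule.mem_sup_right ((monomial_mem_restrictSupport K).2 (Or.inl h))
    · exact Submodule.mem_sup_left ((monomial_mem_restrictSupport K).2 (Or.inl h))

/-- The `K`-algebra automorphism `X_i ↦ X_i + p_i` of the polynomial ring. -/
def translateEquiv {σ K : Type*} [Field K] (p : σ → K) : MvPolynomial σ K ≃ₐ[K] MvPolynomial σ K :=
  AlgEquiv.ofAlgHom (aeval fun i => X i + C (p i)) (aeval fun i => X i - C (p i))
    (by ext i; simp) (by ext i; simp)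

theorem map_translateEquiv_pointIdeal {K : Type*} [Field K] {n : ℕ} (p : Fin n → K) :
    (pointIdeal K p).map (translateEquiv p : MvPolynomial (Fin n) K →+* MvPolynomial (Fin n) K) =
      idealOfVars (Fin n) K := by
  have key (f : MvPolynomial (Fin n) K) :
      eval p f = constantCoeff (translateEquiv p f) := by
    have : (aeval p : MvPolynomial (Fin n) K →ₐ[K] K) =
        (aeval (0 : Fin n → K)).comp (translateEquiv p).toAlgHom := by
      ext i; simp [translateEquiv]
    simpa [constantCoeff_eq] using DFunLike.congr_fun this f
  have hmem (f : MvPolynomial (Fin n) K) : f ∈ idealOfVars (Fin n) K ↔ constantCoeff f = 0 := by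
    rw [← pow_one (idealOfVars (Fin n) K), mem_pow_idealOfVars_iff']
    simp [constantCoeff_eq, Finsupp.degree_eq_zero_iff]
  ext f
  constructor
  · intro hf
    obtain ⟨g, hg, rfl⟩ := (Ideal.mem_map_iff_of_surjective _ (translateEquiv p).surjective).1 hf
    rw [hmem]
    exact (key g).symm.trans hg
  · intro hf
    obtain ⟨g, rfl⟩ := (translateEquiv p).surjective f
    exact Ideal.mem_map_of_mem _ ((key g).trans ((hmem _).1 hf))

/-- Modulo the `(m+1)`-st power of the ideal of a point, every polynomial is represented by a
unique polynomial of degree at most `m`. -/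
def quotientPowPointIdealEquiv {K : Type*} [Field K] {n : ℕ} (p : Fin n → K) (m : ℕ) :
    (MvPolynomial (Fin n) K ⧸ pointIdeal K p ^ (m + 1)) ≃ₗ[K] restrictTotalDegree (Fin n) K m :=
  (Ideal.quotientEquivAlg _ (idealOfVars (Fin n) K ^ (m + 1)) (translateEquiv p) (by
    rw [Ideal.map_pow, map_translateEquiv_pointIdeal])).toLinearEquiv ≪≫ₗ
  (Submodule.Quotient.restrictScalarsEquiv K _).symm ≪≫ₗ
  Submodule.quotientEquivOfIsCompl _ _ (isCompl_pow_idealOfVars_restrictTotalDegree (Fin n) K m)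

theorem finite_quotient_pow_pointIdeal {K : Type*} [Field K] {n : ℕ} (p : Fin n → K) {m : ℕ}
    (hm : 1 ≤ m) : Module.Finite K (MvPolynomial (Fin n) K ⧸ pointIdeal K p ^ m) := by
  obtain ⟨m, rfl⟩ := Nat.exists_eq_add_of_le' hm
  exact Module.Finite.equiv (quotientPowPointIdealEquiv p m).symm

theorem finrank_quotient_pow_pointIdeal {K : Type*} [Field K] {n : ℕ} (p : Fin n → K) {m : ℕ}
    (hm : 1 ≤ m) :
    Module.finrank K (MvPolynomial (Fin n) K ⧸ pointIdeal K p ^ m) = (m + n - 1).choose n := by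
  obtain ⟨m, rfl⟩ := Nat.exists_eq_add_of_le' hm
  rw [(quotientPowPointIdealEquiv p m).finrank_eq, finrank_restrictTotalDegree]
  congr 1
  omega

theorem isCoprime_pointIdeal {K : Type*} [Field K] {n : ℕ} {p q : Fin n → K} (h : p ≠ q) :
    IsCoprime (pointIdeal K p) (pointIdeal K q) := by
  obtain ⟨i, hi⟩ := Function.ne_iff.1 h
  have hi' : q i - p i ≠ 0 := sub_ne_zero.2 hi.symm
  refine Ideal.isCoprime_iff_exists.2 ⟨C (q i - p i)⁻¹ * (X i - C (p i)), ?_,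
    C (q i - p i)⁻¹ * (C (q i) - X i), ?_, ?_⟩
  · simp [pointIdeal, RingHom.mem_ker]
  · simp [pointIdeal, RingHom.mem_ker]
  · rw [← mul_add, sub_add_sub_cancel', ← C_sub, ← C_mul, inv_mul_cancel₀ hi', C_1]

/-- Rank-nullity for the restriction of a linear map to a finite-dimensional subspace. -/
theorem finrank_map_add_finrank_ker_inf {K V W : Type*} [Field K] [AddCommGroup V] [Module K V]
    [AddCommGroup W] [Module K W] (f : V →ₗ[K] W) (S : Submodule K V) [Module.Finite K S] :
    Module.finrank K (S.map f) + Module.finrank K ↥(LinearMap.ker f ⊓ S) = Module.finrank K S := by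
  rw [← LinearMap.finrank_range_add_finrank_ker (f.domRestrict S), LinearMap.range_domRestrict,
    LinearMap.ker_domRestrict,
    (Submodule.equivSubtypeMap S (Submodule.comap S.subtype (LinearMap.ker f))).finrank_eq,
    Submodule.map_comap_subtype, inf_comm]

/-- A surjective linear map from a polynomial ring onto a finite-dimensional space is already
surjective on polynomials of bounded degree. -/
theorem exists_map_restrictTotalDegree_eq_top {σ K W : Type*} [Field K] [AddCommGroup W]
    [Module K W] [Module.Finite K W] (f : MvPolynomial σ K →ₗ[K] W)
    (hf : Function.Surjective f) :
    ∃ T, ∀ t, T ≤ t → (restrictTotalDegree σ K t).map f = ⊤ := by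
  obtain ⟨s, hs⟩ := (Module.Finite.fg_top : (⊤ : Submodule K W).FG)
  choose g hg using hf
  refine ⟨s.sup fun w => (g w).totalDegree, fun t ht => ?_⟩
  rw [eq_top_iff, ← hs, Submodule.span_le]
  intro w hw
  refine ⟨g w, (mem_restrictTotalDegree _ _ _).2 (le_trans ?_ ht), hg w⟩
  exact Finset.le_sup (f := fun w => (g w).totalDegree) hw

/-- for distinct points `p_i ∈ K^n` and `m_i ≥ 1`, with
`I = ⋂ I(p_i)^{m_i}`, one has `H^≤_I(t) ≥ C(t+n,n) − Σ_i C(m_i+n−1,n)` for all `t ≥ 0`,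
with equality for all sufficiently large `t`. -/
theorem stmt_8 {K : Type*} [Field K] [IsAlgClosed K]
    (n r : ℕ)
    (p : Fin r → (Fin n → K)) (hp : Function.Injective p)
    (m : Fin r → ℕ) (hm : ∀ i, 1 ≤ m i)
    (I : Ideal (MvPolynomial (Fin n) K)) (hI : I = ⨅ i, (pointIdeal K (p i)) ^ (m i)) :
    (∀ t : ℕ,
      (Nat.choose (t + n) n : ℤ) - ∑ i : Fin r, (Nat.choose (m i + n - 1) n : ℤ)
        ≤ (hilbLe K I t : ℤ)) ∧
    (∃ T : ℕ, ∀ t : ℕ, T ≤ t →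
      (hilbLe K I t : ℤ)
        = (Nat.choose (t + n) n : ℤ) - ∑ i : Fin r, (Nat.choose (m i + n - 1) n : ℤ)) := by
  let J : Fin r → Ideal (MvPolynomial (Fin n) K) := fun i => pointIdeal K (p i) ^ m i
  let Φ : MvPolynomial (Fin n) K →ₗ[K] (∀ i, MvPolynomial (Fin n) K ⧸ J i) :=
    LinearMap.pi fun i => (Ideal.Quotient.mkₐ K (J i)).toLinearMap
  have : ∀ i, Module.Finite K (MvPolynomial (Fin n) K ⧸ J i) := fun i =>
    finite_quotient_pow_pointIdeal (p i) (hm i)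
  have hker : LinearMap.ker Φ = I.restrictScalars K := by
    ext f
    simp [Φ, J, hI, funext_iff, Ideal.Quotient.eq_zero_iff_mem, Submodule.mem_iInf]
  have hsurj : Function.Surjective Φ := fun x => by
    obtain ⟨f, hf⟩ := Ideal.pi_quotient_surjective (I := J)
      (fun i j hij => (isCoprime_pointIdeal (hp.ne hij)).pow) x
    exact ⟨f, funext hf⟩
  have hdim : Module.finrank K (∀ i, MvPolynomial (Fin n) K ⧸ J i) =
      ∑ i, (m i + n - 1).choose n := by
    rw [Module.finrank_pi_fintype]
    exact Finset.sum_congr rfl fun i _ => finrank_quotient_pow_pointIdeal (p i) (hm i)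
  have hadd (t : ℕ) : Module.finrank K ((restrictTotalDegree (Fin n) K t).map Φ) + hilbLe K I t =
      (t + n).choose n := by
    rw [hilbLe, ← hker, finrank_map_add_finrank_ker_inf, finrank_restrictTotalDegree]
  constructor
  · intro t
    have hle := Submodule.finrank_le ((restrictTotalDegree (Fin n) K t).map Φ)
    rw [hdim] at hle
    have := hadd t
    zify at this hle
    linarith
  · obtain ⟨T, hT⟩ := exists_map_restrictTotalDegree_eq_top Φ hsurj
    refine ⟨T, fun t ht => ?_⟩
    have := hadd t
    rw [hT t ht, finrank_top, hdim] at this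
    zify at this
    linarith
end
end

section
/- For every integer s ≥ 9, the infimum of the set { t/m : t, m positive integers with C(t+2,2) − s·C(m+1,2) > 0 } equals √s. -/
open MvPolynomial Filter
open scoped Classical

noncomputable section

theorem mul_choose_two_lt_choose_two_iff (s t m : ℕ) :
    s * Nat.choose (m + 1) 2 < Nat.choose (t + 2) 2 ↔
      s * (m * (m + 1)) < (t + 1) * (t + 2) := by
  rw [← Nat.cast_lt (α := ℝ), ← Nat.cast_lt (α := ℝ)]
  push_cast [Nat.cast_choose_two]
  constructor <;> intro h <;> linarith

theorem sqrt_mul_le_of_lt {s t m : ℕ} (hs : 9 ≤ s)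
    (h : s * (m * (m + 1)) < (t + 1) * (t + 2)) : √(s : ℝ) * m ≤ t := by
  suffices hsq : s * m ^ 2 ≤ t ^ 2 by
    rw [← Real.sqrt_sq (Nat.cast_nonneg m : (0 : ℝ) ≤ m), ← Real.sqrt_mul (Nat.cast_nonneg s)]
    exact Real.sqrt_le_iff.2 ⟨Nat.cast_nonneg t, by exact_mod_cast hsq⟩
  by_contra! hlt
  have hlin : 3 * t < s * m := by
    refine lt_of_pow_lt_pow_left₀ 2 (Nat.zero_le _) ?_
    calc (3 * t) ^ 2 = 9 * t ^ 2 := by ring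
      _ < 9 * (s * m ^ 2) := by gcongr
      _ ≤ s * (s * m ^ 2) := by gcongr
      _ = (s * m) ^ 2 := by ring
  nlinarith

theorem mul_lt_of_sqrt_mul_add_le {s t m : ℕ} (hs : 1 ≤ s) (h : √(s : ℝ) * m + s ≤ t) :
    s * (m * (m + 1)) < (t + 1) * (t + 2) := by
  rw [← Nat.cast_lt (α := ℝ)]
  push_cast
  have hsq : √(s : ℝ) ^ 2 = s := Real.sq_sqrt (Nat.cast_nonneg s)
  have hs' : (1 : ℝ) ≤ s := by exact_mod_cast hs
  have hr : 1 ≤ √(s : ℝ) := Real.one_le_sqrt.2 hs'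
  have hm : (0 : ℝ) ≤ m := Nat.cast_nonneg m
  calc (s : ℝ) * (m * (m + 1)) = (√(s : ℝ) * m) ^ 2 + s * m * 1 := by rw [mul_pow, hsq]; ring
    _ ≤ (√(s : ℝ) * m) ^ 2 + s * m * √(s : ℝ) := by gcongr
    _ ≤ (√(s : ℝ) * m + s) ^ 2 := by
      have : 0 ≤ s * m * √(s : ℝ) := by positivity
      nlinarith [sq_nonneg (s : ℝ)]
    _ ≤ (t : ℝ) ^ 2 := by gcongr
    _ < (t + 1) * (t + 2) := by nlinarith [(Nat.cast_nonneg t : (0 : ℝ) ≤ t)]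

/-- for `s ≥ 9`,
`inf { t/m : C(t+2,2) − s·C(m+1,2) > 0, t, m ≥ 1 } = √s`. -/
theorem stmt_12 (s : ℕ) (hs : 9 ≤ s) :
    sInf { x : ℝ | ∃ t m : ℕ, 0 < t ∧ 0 < m ∧
        s * Nat.choose (m + 1) 2 < Nat.choose (t + 2) 2 ∧ x = (t : ℝ) / (m : ℝ) }
      = Real.sqrt s := by
  simp only [mul_choose_two_lt_choose_two_iff]
  refine IsGLB.csInf_eq (isGLB_of_mem_closure ?_ ?_) ?_
  · rintro x ⟨t, m, -, hm, h, rfl⟩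
    rw [le_div_iff₀ (Nat.cast_pos.2 hm)]
    exact sqrt_mul_le_of_lt hs h
  · have hlim : Tendsto (fun m : ℕ => (⌈√(s : ℝ) * (m : ℝ)⌉₊ : ℝ) / (m : ℝ) + (s : ℝ) / (m : ℝ))
        atTop (nhds √(s : ℝ)) := by
      simpa using ((tendsto_nat_ceil_mul_div_atTop (Real.sqrt_nonneg (s : ℝ))).comp
        tendsto_natCast_atTop_atTop).add (tendsto_const_div_atTop_nhds_zero_nat (s : ℝ))
    refine mem_closure_of_tendsto hlim ?_
    filter_upwards [eventually_gt_atTop 0] with m hm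
    refine ⟨⌈√(s : ℝ) * (m : ℝ)⌉₊ + s, m, by omega, hm, ?_, by push_cast; ring⟩
    refine mul_lt_of_sqrt_mul_add_le (by omega) ?_
    push_cast
    gcongr
    exact Nat.le_ceil _
  · refine ⟨_, ⌈√(s : ℝ) * ((1 : ℕ) : ℝ)⌉₊ + s, 1, by omega, one_pos, ?_, rfl⟩
    refine mul_lt_of_sqrt_mul_add_le (by omega) ?_
    push_cast
    gcongr
    exact Nat.le_ceil _
end
end

section
/- Let p_1,…,p_r ∈ P^n be distinct points, let m_1,…,m_r be positive integers, and let I = ⋂_i I(p_i)^{m_i}. Then H_{R/I} is strictly increasing until it becomes constant: if c is the least t with H_{R/I}(c) = H_{R/I}(c+1), then H_{R/I}(t) < H_{R/I}(t+1) for 0 ≤ t < c, and H_{R/I}(t) = H_{R/I}(c) for all t ≥ c. -/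
open MvPolynomial Filter
open scoped Classical

noncomputable section

/-- The order of vanishing along the zero section is unchanged by multiplication with a polynomial
whose constant coefficient is nonzero. -/
theorem mem_pow_idealOfVars_of_mul_mem {σ A : Type*} [CommRing A] [IsDomain A]
    {f g : MvPolynomial σ A} {m : ℕ} (hg : constantCoeff g ≠ 0)
    (h : g * f ∈ idealOfVars σ A ^ m) : f ∈ idealOfVars σ A ^ m := by
  rw [mem_pow_idealOfVars_iff'] at h ⊢
  intro d
  induction d using WellFoundedLT.induction with
  | ind d ih =>
    intro hd
    have hsum := h d hd
    rw [coeff_mul, Finset.sum_eq_single (0, d)] at hsum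
    · exact (mul_eq_zero.mp hsum).resolve_left hg
    · rintro ⟨a, b⟩ hab hne
      replace hab : a + b = d := Finset.HasAntidiagonal.mem_antidiagonal.mp hab
      have hb : b < d := by
        refine lt_of_le_of_ne (hab ▸ le_add_self) fun hbd => hne ?_
        subst hbd
        simpa using hab
      rw [ih b hb ((Finsupp.degree_mono hb.le).trans_lt hd), mul_zero]
    · simp

/-- Expansion of a polynomial around the line `T ↦ T • p`. -/
def expandAlongLine {σ K : Type*} [Field K] (p : σ → K) :
    MvPolynomial σ K →+* MvPolynomial σ (Polynomial K) :=
  eval₂Hom (C.comp Polynomial.C) fun i => X i + C (Polynomial.C (p i) * Polynomial.X)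

/-- A retraction of `expandAlongLine p`. When `p k ≠ 0`, it sends the variables to linear forms
vanishing at `p`. -/
def contractLine {σ K : Type*} [Field K] (p : σ → K) (k : σ) :
    MvPolynomial σ (Polynomial K) →+* MvPolynomial σ K :=
  eval₂Hom (Polynomial.eval₂RingHom C (C (p k)⁻¹ * X k)) fun i => X i - C (p i * (p k)⁻¹) * X k

theorem contractLine_expandAlongLine {σ K : Type*} [Field K] (p : σ → K) (k : σ)
    (f : MvPolynomial σ K) : contractLine p k (expandAlongLine p f) = f := by
  have h : (contractLine p k).comp (expandAlongLine p) = RingHom.id _ := by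
    refine MvPolynomial.ringHom_ext (fun a => ?_) fun i => ?_
    · simp [contractLine, expandAlongLine]
    · simp [contractLine, expandAlongLine, mul_assoc]
  exact RingHom.congr_fun h f

theorem constantCoeff_expandAlongLine {σ K : Type*} [Field K] (p : σ → K)
    {f : MvPolynomial σ K} {d : ℕ} (hf : f.IsHomogeneous d) :
    constantCoeff (expandAlongLine p f) = Polynomial.C (eval p f) * Polynomial.X ^ d := by
  have h : constantCoeff (expandAlongLine p f) =
      eval₂ Polynomial.C (fun i => Polynomial.C (p i) * Polynomial.X) f := by
    rw [expandAlongLine, coe_eval₂Hom, hom_eval₂]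
    congr 1
    · exact RingHom.ext fun a => constantCoeff_C _ _
    · ext1 i
      simp
  rw [h, eval₂_eq, eval_eq, map_sum, Finset.sum_mul]
  refine Finset.sum_congr rfl fun s hs => ?_
  simp only [mul_pow, Finset.prod_mul_distrib, map_mul, map_prod, map_pow,
    Finset.prod_pow_eq_pow_sum]
  rw [← hf.degree_eq_sum_deg_support hs, mul_assoc]

/-- A power of the ideal of a projective point is detected by the expansion along the line over
that point. -/
theorem mem_projPointIdeal_pow_iff {N : ℕ} {K : Type*} [Field K] {p : Fin N → K} (hp : p ≠ 0)
    {m : ℕ} {f : MvPolynomial (Fin N) K} :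
    f ∈ projPointIdeal K p ^ m ↔
      expandAlongLine p f ∈ idealOfVars (Fin N) (Polynomial K) ^ m := by
  constructor
  · intro h
    have hle : (projPointIdeal K p).map (expandAlongLine p) ≤ idealOfVars _ _ := by
      rw [projPointIdeal, Ideal.map_span, Ideal.span_le]
      rintro _ ⟨g, ⟨⟨d, hd⟩, hg⟩, rfl⟩
      rw [SetLike.mem_coe, ← pow_one (idealOfVars _ _), mem_pow_idealOfVars_iff']
      intro x hx
      obtain rfl : x = 0 := (Finsupp.degree_eq_zero_iff x).mp (by simpa using hx)
      rw [← constantCoeff_eq]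
      exact (constantCoeff_expandAlongLine p hd).trans (by simp [hg])
    have := Ideal.mem_map_of_mem (expandAlongLine p) h
    rw [Ideal.map_pow] at this
    exact Ideal.pow_right_mono hle m this
  · obtain ⟨k, hk⟩ := Function.ne_iff.mp hp
    have hle : (idealOfVars (Fin N) (Polynomial K)).map (contractLine p k) ≤
        projPointIdeal K p := by
      rw [idealOfVars, Ideal.map_span, Ideal.span_le, Set.image_subset_iff, Set.range_subset_iff]
      intro i
      have hi : contractLine p k (X i) = X i - C (p i * (p k)⁻¹) * X k := eval₂Hom_X' _ _ _
      rw [Set.mem_preimage, hi]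
      refine Ideal.subset_span ⟨⟨1, ?_⟩, ?_⟩
      · exact (isHomogeneous_X K i).sub (isHomogeneous_C_mul_X _ k)
      · have : p k ≠ 0 := hk
        simp [this]
    intro h
    have := Ideal.mem_map_of_mem (contractLine p k) h
    rw [Ideal.map_pow, contractLine_expandAlongLine] at this
    exact Ideal.pow_right_mono hle m this

theorem mem_projPointIdeal_pow_of_mul_mem {N : ℕ} {K : Type*} [Field K] {p : Fin N → K}
    (hp : p ≠ 0) {m d : ℕ} {f l : MvPolynomial (Fin N) K} (hl : l.IsHomogeneous d)
    (hlp : eval p l ≠ 0) (h : l * f ∈ projPointIdeal K p ^ m) : f ∈ projPointIdeal K p ^ m := by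
  rw [mem_projPointIdeal_pow_iff hp] at h ⊢
  rw [map_mul] at h
  refine mem_pow_idealOfVars_of_mul_mem ?_ h
  rw [constantCoeff_expandAlongLine p hl]
  simpa using hlp

/-- Over an infinite field some linear form vanishes at none of finitely many nonzero vectors. -/
theorem exists_linearForm_eval_ne_zero {N : ℕ} {ι K : Type*} [Finite ι] [Field K] [Infinite K]
    (p : ι → Fin N → K) (hp : ∀ i, p i ≠ 0) :
    ∃ l : MvPolynomial (Fin N) K, l.IsHomogeneous 1 ∧ ∀ i, eval (p i) l ≠ 0 := by
  obtain ⟨φ, hφ⟩ := Module.exists_dual_forall_apply_ne_zero (K := K) p hp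
  refine ⟨∑ j, C (φ fun k => if j = k then 1 else 0) * X j,
    IsHomogeneous.sum _ _ _ fun j _ => isHomogeneous_C_mul_X _ j, fun i h => hφ i ?_⟩
  rw [LinearMap.pi_apply_eq_sum_univ φ (p i)]
  refine Eq.trans ?_ h
  simp [mul_comm]

/-- The degree-`t` part of the quotient by `I`. -/
def gradedQuotient {N : ℕ} {K : Type*} [Field K] (I : Ideal (MvPolynomial (Fin N) K)) (t : ℕ) :
    Submodule K (MvPolynomial (Fin N) K ⧸ I) :=
  (homogeneousSubmodule (Fin N) K t).map (Ideal.Quotient.mkₐ K I).toLinearMap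

instance {N : ℕ} {K : Type*} [Field K] (t : ℕ) :
    Module.Finite K (homogeneousSubmodule (Fin N) K t) :=
  Module.Finite.iff_fg.mpr (homogeneousSubmodule_fg _ _ t)

instance {N : ℕ} {K : Type*} [Field K] (I : Ideal (MvPolynomial (Fin N) K)) (t : ℕ) :
    Module.Finite K (gradedQuotient I t) := by
  unfold gradedQuotient
  infer_instance

theorem hilbProj_eq_finrank {N : ℕ} {K : Type*} [Field K] (I : Ideal (MvPolynomial (Fin N) K))
    (t : ℕ) : hilbProj K I t = Module.finrank K (gradedQuotient I t) := by
  set S := homogeneousSubmodule (Fin N) K t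
  let φ := (Ideal.Quotient.mkₐ K I).toLinearMap.domRestrict S
  have hr : LinearMap.range φ = gradedQuotient I t := LinearMap.range_domRestrict _ _
  have hk : (LinearMap.ker φ).map S.subtype = Submodule.restrictScalars K I ⊓ S := by
    ext f
    simp [φ, Ideal.Quotient.eq_zero_iff_mem, and_comm]
  have h := φ.finrank_range_add_finrank_ker
  rw [hr, (Submodule.equivMapOfInjective S.subtype S.subtype_injective _).finrank_eq, hk] at h
  rw [hilbProj, ← h, Nat.add_sub_cancel]

theorem gradedQuotient_succ {N : ℕ} {K : Type*} [Field K] (I : Ideal (MvPolynomial (Fin N) K))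
    (t : ℕ) : gradedQuotient I (t + 1) = gradedQuotient I t * gradedQuotient I 1 := by
  simp only [gradedQuotient]
  rw [← Submodule.map_mul, ← homogeneousSubmodule_one_pow _ (t + 1), pow_succ,
    homogeneousSubmodule_one_pow]

section
variable {N : ℕ} {K : Type*} [Field K] {I : Ideal (MvPolynomial (Fin N) K)}
  {l : MvPolynomial (Fin N) K}

theorem map_mulLeft_gradedQuotient_le (hl : l.IsHomogeneous 1) (t : ℕ) :
    (gradedQuotient I t).map (LinearMap.mulLeft K (Ideal.Quotient.mk I l)) ≤
      gradedQuotient I (t + 1) := by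
  rintro _ ⟨x, hx, rfl⟩
  rw [gradedQuotient_succ, LinearMap.mulLeft_apply, mul_comm]
  exact Submodule.mul_mem_mul hx ⟨l, hl, rfl⟩

theorem finrank_map_mulLeft_gradedQuotient (hreg : ∀ f, l * f ∈ I → f ∈ I) (t : ℕ) :
    Module.finrank K ((gradedQuotient I t).map (LinearMap.mulLeft K (Ideal.Quotient.mk I l))) =
      hilbProj K I t := by
  rw [hilbProj_eq_finrank]
  refine (Submodule.equivMapOfInjective _ ?_ _).finrank_eq.symm
  rw [← LinearMap.ker_eq_bot, LinearMap.ker_eq_bot']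
  intro x hx
  obtain ⟨f, rfl⟩ := Ideal.Quotient.mk_surjective x
  rw [LinearMap.mulLeft_apply, ← map_mul, Ideal.Quotient.eq_zero_iff_mem] at hx
  exact Ideal.Quotient.eq_zero_iff_mem.mpr (hreg f hx)

theorem hilbProj_le_succ (hl : l.IsHomogeneous 1) (hreg : ∀ f, l * f ∈ I → f ∈ I) (t : ℕ) :
    hilbProj K I t ≤ hilbProj K I (t + 1) := by
  rw [← finrank_map_mulLeft_gradedQuotient hreg, hilbProj_eq_finrank]
  exact Submodule.finrank_mono (map_mulLeft_gradedQuotient_le hl t)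

theorem hilbProj_eq_succ_iff (hl : l.IsHomogeneous 1) (hreg : ∀ f, l * f ∈ I → f ∈ I) (t : ℕ) :
    hilbProj K I t = hilbProj K I (t + 1) ↔
      (gradedQuotient I t).map (LinearMap.mulLeft K (Ideal.Quotient.mk I l)) =
        gradedQuotient I (t + 1) := by
  rw [← finrank_map_mulLeft_gradedQuotient hreg, hilbProj_eq_finrank]
  exact ⟨Submodule.eq_of_le_of_finrank_eq (map_mulLeft_gradedQuotient_le hl t),
    fun h => by rw [h]⟩

theorem hilbProj_succ_eq_of_eq (hl : l.IsHomogeneous 1) (hreg : ∀ f, l * f ∈ I → f ∈ I) {t : ℕ}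
    (h : hilbProj K I t = hilbProj K I (t + 1)) :
    hilbProj K I (t + 1) = hilbProj K I (t + 2) := by
  rw [hilbProj_eq_succ_iff hl hreg] at h ⊢
  have hmap : ∀ V : Submodule K (MvPolynomial (Fin N) K ⧸ I),
      V.map (LinearMap.mulLeft K (Ideal.Quotient.mk I l)) =
        Submodule.span K {Ideal.Quotient.mk I l} * V := fun V => by
    rw [Submodule.span_singleton_mul]
    rfl
  rw [hmap] at h ⊢
  calc Submodule.span K {Ideal.Quotient.mk I l} * gradedQuotient I (t + 1)
      = Submodule.span K {Ideal.Quotient.mk I l} * (gradedQuotient I t * gradedQuotient I 1) := by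
        rw [gradedQuotient_succ I t]
    _ = Submodule.span K {Ideal.Quotient.mk I l} * gradedQuotient I t * gradedQuotient I 1 :=
        (mul_assoc (Submodule.span K {Ideal.Quotient.mk I l}) _ _).symm
    _ = gradedQuotient I (t + 2) := by rw [h, ← gradedQuotient_succ I (t + 1)]

end

/-- the Hilbert function of a fat point subscheme of `ℙ^n` is strictly
increasing until it becomes constant: if `c` is least with `H(c) = H(c+1)` then `H` is
strictly increasing below `c` and constant from `c` on. -/
theorem stmt_15 {K : Type*} [Field K] [IsAlgClosed K]
    (n r : ℕ)
    (p : Fin r → (Fin (n + 1) → K)) (hp0 : ∀ i, p i ≠ 0)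
    (hpdist : ∀ i j, i ≠ j → ∀ c : K, p i ≠ c • p j)
    (m : Fin r → ℕ) (hm : ∀ i, 1 ≤ m i)
    (I : Ideal (MvPolynomial (Fin (n + 1)) K))
    (hI : I = ⨅ i, (projPointIdeal K (p i)) ^ (m i))
    (c : ℕ)
    (hc : hilbProj K I c = hilbProj K I (c + 1))
    (hcmin : ∀ t : ℕ, t < c → hilbProj K I t ≠ hilbProj K I (t + 1)) :
    (∀ t : ℕ, t < c → hilbProj K I t < hilbProj K I (t + 1)) ∧
    (∀ t : ℕ, c ≤ t → hilbProj K I t = hilbProj K I c) := by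
  obtain ⟨l, hl, hlp⟩ := exists_linearForm_eval_ne_zero p hp0
  have hreg : ∀ f, l * f ∈ I → f ∈ I := by
    intro f hf
    rw [hI, Ideal.mem_iInf] at hf ⊢
    exact fun i => mem_projPointIdeal_pow_of_mul_mem (hp0 i) hl (hlp i) (hf i)
  refine ⟨fun t ht => (hilbProj_le_succ hl hreg t).lt_of_ne (hcmin t ht), fun t ht => ?_⟩
  have hstep : ∀ t, c ≤ t → hilbProj K I t = hilbProj K I (t + 1) := fun t ht =>
    Nat.le_induction hc (fun _ _ => hilbProj_succ_eq_of_eq hl hreg) t ht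
  induction t, ht using Nat.le_induction with
  | base => rfl
  | succ t ht ih => rw [← hstep t ht, ih]
end
end

section
/- Let s ≥ 2 and let L_1,…,L_s be distinct lines in P² such that no three of the lines pass through a common point. Let I be the radical ideal of the C(s,2) points of pairwise intersection of the lines. Then for every integer m ≥ 1: α(I^{(m)}) = ms/2 if m is even, and α(I^{(m)}) = (m+1)s/2 − 1 if m is odd. -/
open MvPolynomial Filter
open scoped Classical

noncomputable section

namespace MvPolynomial

variable {n : ℕ} {K : Type*} [Field K]

/-- Translation of polynomials, moving the point `p` to the origin. -/
def translate (p : Fin n → K) : MvPolynomial (Fin n) K →ₐ[K] MvPolynomial (Fin n) K :=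
  aeval fun i => X i + C (p i)

/-- The order of vanishing of `f` at the point `p` of affine space. -/
def orderAt (p : Fin n → K) (f : MvPolynomial (Fin n) K) : ℕ∞ :=
  MvPowerSeries.order (translate p f : MvPowerSeries (Fin n) K)

theorem orderAt_mul (p : Fin n → K) (f g : MvPolynomial (Fin n) K) :
    orderAt p (f * g) = orderAt p f + orderAt p g := by
  simp [orderAt, MvPowerSeries.order_mul]

theorem constantCoeff_translate (p : Fin n → K) (f : MvPolynomial (Fin n) K) :
    constantCoeff (translate p f) = eval p f := by
  induction f using MvPolynomial.induction_on with
  | C a => simp [translate]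
  | add f g hf hg => simp [hf, hg]
  | mul_X f i hf => rw [map_mul, map_mul, hf]; simp [translate]

theorem orderAt_eq_zero {p : Fin n → K} {f : MvPolynomial (Fin n) K} (h : eval p f ≠ 0) :
    orderAt p f = 0 := by
  have h0 : coeff 0 (translate p f) ≠ 0 := by
    rwa [← constantCoeff_translate p f] at h
  have := MvPowerSeries.order_le (f := (translate p f : MvPowerSeries (Fin n) K)) (d := 0)
    (by simpa using h0)
  simpa [orderAt] using this

theorem le_orderAt_iff {p : Fin n → K} {f : MvPolynomial (Fin n) K} {m : ℕ} :
    (m : ℕ∞) ≤ orderAt p f ↔ translate p f ∈ idealOfVars (Fin n) K ^ m := by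
  rw [mem_pow_idealOfVars_iff']
  constructor
  · intro h x hx
    rw [← coeff_coe]
    exact MvPowerSeries.coeff_of_lt_order (lt_of_lt_of_le (by exact_mod_cast hx) h)
  · intro h
    refine MvPowerSeries.nat_le_order fun x hx => ?_
    rw [coeff_coe]
    exact h x hx

theorem translate_mem_idealOfVars {p : Fin n → K} {f : MvPolynomial (Fin n) K}
    (h : eval p f = 0) : translate p f ∈ idealOfVars (Fin n) K := by
  rw [← pow_one (idealOfVars (Fin n) K), mem_pow_idealOfVars_iff']
  intro x hx
  have : x = 0 := by simpa [Finsupp.degree_eq_zero_iff] using Nat.lt_one_iff.mp hx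
  rw [this, ← h, ← constantCoeff_translate p f]
  rfl

theorem IsHomogeneous.eval_smul {f : MvPolynomial (Fin n) K} {d : ℕ} (hf : f.IsHomogeneous d)
    (c : K) (p : Fin n → K) : eval (c • p) f = c ^ d * eval p f := by
  rw [eval_eq', eval_eq', Finset.mul_sum]
  refine Finset.sum_congr rfl fun x hx => ?_
  have hd : ∑ i, x i = d := by
    have := hf (mem_support_iff.mp hx)
    rwa [Finsupp.weight_apply, Finsupp.sum_fintype _ _ (by simp), Finset.sum_congr rfl] at this
    simp
  simp only [Pi.smul_apply, smul_eq_mul, mul_pow, Finset.prod_mul_distrib]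
  rw [Finset.prod_pow_eq_pow_sum, hd]
  ring

theorem le_orderAt_of_mem_projPointIdeal_pow {p : Fin n → K} {f : MvPolynomial (Fin n) K} {m : ℕ}
    (hf : f ∈ projPointIdeal K p ^ m) (c : K) : (m : ℕ∞) ≤ orderAt (c • p) f := by
  rw [le_orderAt_iff]
  have hle : projPointIdeal K p ≤ (idealOfVars (Fin n) K).comap (translate (c • p)).toRingHom := by
    refine Ideal.span_le.mpr ?_
    rintro g ⟨⟨d, hd⟩, hg⟩
    refine translate_mem_idealOfVars ?_
    rw [hd.eval_smul, hg, mul_zero]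
  exact Ideal.le_comap_pow _ m (Ideal.pow_right_mono hle m hf)

theorem eval_eq_zero_of_one_le_orderAt {p : Fin n → K} {f : MvPolynomial (Fin n) K} {m : ℕ}
    (hm : 1 ≤ m) (h : (m : ℕ∞) ≤ orderAt p f) : eval p f = 0 := by
  by_contra h0
  rw [orderAt_eq_zero h0] at h
  have : m = 0 := by simpa using h
  omega

/-- The restriction of `f` to the parametrized affine line `t ↦ p + t v`. -/
def restrictLine (p v : Fin n → K) : MvPolynomial (Fin n) K →ₐ[K] Polynomial K :=
  aeval fun i => Polynomial.C (p i) + Polynomial.C (v i) * Polynomial.X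

theorem eval_restrictLine (p v : Fin n → K) (f : MvPolynomial (Fin n) K) (t : K) :
    (restrictLine p v f).eval t = eval (p + t • v) f := by
  induction f using MvPolynomial.induction_on with
  | C a => simp [restrictLine]
  | add f g hf hg => simp [hf, hg]
  | mul_X f i hf =>
    have hX : (restrictLine p v (X i)).eval t = p i + v i * t := by simp [restrictLine]
    rw [map_mul, map_mul, Polynomial.eval_mul, hf, hX, eval_X, Pi.add_apply, Pi.smul_apply,
      smul_eq_mul, mul_comm t]

theorem natDegree_restrictLine_le (p v : Fin n → K) (f : MvPolynomial (Fin n) K) :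
    (restrictLine p v f).natDegree ≤ f.totalDegree := by
  have := aeval_natDegree_le f le_rfl
    (fun i => Polynomial.C (p i) + Polynomial.C (v i) * Polynomial.X) (n := 1)
    (fun i => by compute_degree)
  rwa [mul_one] at this

theorem pow_dvd_restrictLine {p v : Fin n → K} {f : MvPolynomial (Fin n) K} {m : ℕ} {t : K}
    (h : (m : ℕ∞) ≤ orderAt (p + t • v) f) :
    (Polynomial.X - Polynomial.C t) ^ m ∣ restrictLine p v f := by
  let ψ : MvPolynomial (Fin n) K →ₐ[K] Polynomial K :=
    aeval fun i => Polynomial.C (v i) * (Polynomial.X - Polynomial.C t)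
  have hcomp : restrictLine p v f = ψ (translate (p + t • v) f) := by
    rw [← AlgHom.comp_apply]
    congr 1
    refine algHom_ext fun i => ?_
    simp only [restrictLine, translate, ψ, AlgHom.comp_apply, aeval_X, map_add, algHom_C,
      Pi.add_apply, Pi.smul_apply, smul_eq_mul, Polynomial.algebraMap_eq, map_mul]
    ring
  have hle : idealOfVars (Fin n) K ≤
      (Ideal.span {Polynomial.X - Polynomial.C t}).comap ψ.toRingHom := by
    refine Ideal.span_le.mpr ?_
    rintro _ ⟨i, rfl⟩
    have : ψ (X i) = Polynomial.C (v i) * (Polynomial.X - Polynomial.C t) := by simp [ψ]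
    change ψ (X i) ∈ Ideal.span {Polynomial.X - Polynomial.C t}
    rw [this]
    exact Ideal.mul_mem_left _ _ (Ideal.mem_span_singleton_self _)
  have := Ideal.le_comap_pow _ m (Ideal.pow_right_mono hle m (le_orderAt_iff.mp h))
  rw [Ideal.span_singleton_pow] at this
  rw [hcomp]
  exact Ideal.mem_span_singleton.mp this

theorem eval_eq_zero_of_forall_ne [Infinite K] {f : MvPolynomial (Fin n) K} {y p : Fin n → K}
    (S : Set K) (hS : S.Finite) (h : ∀ u ∉ S, eval (y + u • p) f = 0) : eval y f = 0 := by
  have h0 : restrictLine y p f = 0 := by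
    refine Polynomial.eq_zero_of_infinite_isRoot _ (hS.infinite_compl.mono fun u hu => ?_)
    simpa [Polynomial.IsRoot, eval_restrictLine] using h u hu
  have := eval_restrictLine y p f 0
  simpa [h0] using this.symm

theorem IsHomogeneous.exists_eq_sum {f : MvPolynomial (Fin n) K} (hf : f.IsHomogeneous 1) :
    ∃ a : Fin n → K, f = ∑ i, a i • X i := by
  have : f ∈ Submodule.span K (Set.range (X : Fin n → MvPolynomial (Fin n) K)) := by
    rwa [← homogeneousSubmodule_one_eq_span_X]
  obtain ⟨a, ha⟩ := (Submodule.mem_span_range_iff_exists_fun K).mp this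
  exact ⟨a, ha.symm⟩

theorem IsHomogeneous.irreducible_of_one {f : MvPolynomial (Fin n) K} (hf : f.IsHomogeneous 1)
    (h0 : f ≠ 0) : Irreducible f := by
  refine irreducible_of_totalDegree_eq_one (hf.totalDegree h0) fun x hx => ?_
  rw [isUnit_iff_ne_zero]
  rintro rfl
  exact h0 (MvPolynomial.ext _ _ fun d => by simpa using hx d)

theorem IsHomogeneous.orderAt_le_one {f : MvPolynomial (Fin n) K} (hf : f.IsHomogeneous 1)
    (h0 : f ≠ 0) (p : Fin n → K) : orderAt p f ≤ 1 := by
  obtain ⟨a, rfl⟩ := hf.exists_eq_sum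
  obtain ⟨k, hk⟩ : ∃ k, a k ≠ 0 := by
    by_contra! h
    exact h0 (by simp [h])
  have hne : (0 : Fin n →₀ ℕ) ≠ Finsupp.single k 1 := by simp [eq_comm]
  have hc : coeff (Finsupp.single k 1) (translate p (∑ i, a i • X i)) = a k := by
    simp only [translate, map_sum, map_smul, aeval_X, smul_add, coeff_sum, coeff_add, coeff_smul,
      coeff_X, coeff_C]
    rw [Finset.sum_eq_single k]
    · simp [hne]
    · intro i _ hi
      simp [Finsupp.single_left_inj, hi, hne]
    · simp
  have := MvPowerSeries.order_le (f := (translate p (∑ i, a i • X i) : MvPowerSeries (Fin n) K))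
    (d := Finsupp.single k 1) (by rwa [coeff_coe, hc])
  simpa [orderAt] using this

theorem dvd_of_forall_eval_eq_zero [IsAlgClosed K] {f g : MvPolynomial (Fin n) K}
    (hf : Irreducible f) (h : ∀ x, eval x f = 0 → eval x g = 0) : f ∣ g := by
  have : (Ideal.span {f}).IsPrime := (Ideal.span_singleton_prime hf.ne_zero).mpr hf.prime
  rw [← Ideal.mem_span_singleton, ← IsPrime.vanishingIdeal_zeroLocus (K := K) (Ideal.span {f})]
  intro x hx
  simpa [aeval_eq_eval] using
    h x (by simpa [aeval_eq_eval] using hx f (Ideal.mem_span_singleton_self f))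

/-- Three points of a line in the projective plane are linearly dependent. -/
theorem IsHomogeneous.exists_dependence {f : MvPolynomial (Fin 3) K} (hf : f.IsHomogeneous 1)
    (h0 : f ≠ 0) {x y z : Fin 3 → K} (hx : eval x f = 0) (hy : eval y f = 0) (hz : eval z f = 0) :
    ∃ a b c : K, (a ≠ 0 ∨ b ≠ 0 ∨ c ≠ 0) ∧ a • x + b • y + c • z = 0 := by
  obtain ⟨ℓ, rfl⟩ := hf.exists_eq_sum
  have hℓ : ℓ ≠ 0 := by
    rintro rfl
    exact h0 (by simp)
  have hdet : (Matrix.of ![x, y, z]).det = 0 := by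
    rw [← Matrix.exists_mulVec_eq_zero_iff]
    refine ⟨ℓ, hℓ, ?_⟩
    simp only [map_sum, smul_eval, eval_X] at hx hy hz
    ext i
    simp_rw [mul_comm (ℓ _)] at hx hy hz
    fin_cases i
    exacts [hx, hy, hz]
  obtain ⟨v, hv, hv0⟩ := Matrix.exists_vecMul_eq_zero_iff.mpr hdet
  refine ⟨v 0, v 1, v 2, ?_, ?_⟩
  · by_contra! h
    exact hv (_root_.funext fun i => by fin_cases i <;> simp [h])
  · rw [← hv0]
    ext i
    simp [Matrix.vecMul, dotProduct, Fin.sum_univ_three]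

theorem IsHomogeneous.dvd_of_totalDegree_lt [IsAlgClosed K] {ι : Type*} [Fintype ι] [Nonempty ι]
    {L f : MvPolynomial (Fin 3) K} (hL : L.IsHomogeneous 1) (hL0 : L ≠ 0) (P : ι → Fin 3 → K)
    (hP0 : ∀ j, P j ≠ 0) (hPL : ∀ j, eval (P j) L = 0)
    (hP : ∀ j k, j ≠ k → ∀ c : K, P j ≠ c • P k) {m : ℕ} (hm : 1 ≤ m)
    (hf : ∀ j, ∀ c : K, c ≠ 0 → (m : ℕ∞) ≤ orderAt (c • P j) f)
    (hd : f.totalDegree < m * Fintype.card ι) : L ∣ f := by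
  refine dvd_of_forall_eval_eq_zero (hL.irreducible_of_one hL0) fun y hy => ?_
  by_cases hprop : ∃ (j : ι) (c : K), y = c • P j
  · obtain ⟨j, c, rfl⟩ := hprop
    refine eval_eq_zero_of_forall_ne (p := P j) {-c} (Set.finite_singleton _) fun u hu => ?_
    rw [← add_smul]
    refine eval_eq_zero_of_one_le_orderAt hm (hf j _ fun h => hu ?_)
    exact eq_neg_of_add_eq_zero_right h
  push Not at hprop
  have hy0 : y ≠ 0 := by
    rintro rfl
    exact hprop (Classical.arbitrary ι) 0 (by simp)
  let o : ι := Classical.arbitrary ι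
  have hpar : ∀ j, ∃ γ t : K, γ ≠ 0 ∧ γ • P j = P o + t • y := by
    intro j
    obtain ⟨a, b, c, hne, hdep⟩ := hL.exists_dependence hL0 (hPL j) (hPL o) hy
    have ha : a ≠ 0 := by
      rintro rfl
      have hc : c = 0 := by
        by_contra hc
        refine hprop o (-(b / c)) ?_
        have : c • y = -b • P o := by
          rw [neg_smul]; refine eq_neg_of_add_eq_zero_right (by simpa using hdep)
        rw [← inv_smul_smul₀ hc y, this, smul_smul]
        congr 1; field_simp
      have hb : b ≠ 0 := by simpa [hc] using hne
      have : b • P o = 0 := by simpa [hc] using hdep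
      exact (smul_ne_zero hb (hP0 o)) this
    have hb : b ≠ 0 := by
      rintro rfl
      have hc : c = 0 := by
        by_contra hc
        refine hprop j (-(a / c)) ?_
        have : c • y = -a • P j := by
          rw [neg_smul]; refine eq_neg_of_add_eq_zero_right (by simpa using hdep)
        rw [← inv_smul_smul₀ hc y, this, smul_smul]
        congr 1; field_simp
      have : a • P j = 0 := by simpa [hc] using hdep
      exact (smul_ne_zero ha (hP0 j)) this
    refine ⟨-(a / b), c / b, neg_ne_zero.mpr (div_ne_zero ha hb), ?_⟩
    ext i
    have := congrFun hdep i
    simp only [Pi.add_apply, Pi.smul_apply, smul_eq_mul, Pi.zero_apply] at this ⊢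
    field_simp
    linear_combination -this
  choose γ t hγ ht using hpar
  have htinj : Function.Injective t := by
    intro j k hjk
    by_contra hne
    refine hP j k hne ((γ j)⁻¹ * γ k) ?_
    rw [mul_smul, ht k, ← hjk, ← ht j, inv_smul_smul₀ (hγ j)]
  refine eval_eq_zero_of_forall_ne (p := P o) {0} (Set.finite_singleton _) fun u hu => ?_
  have hu0 : u ≠ 0 := hu
  have hdvd : ∏ j, (Polynomial.X - Polynomial.C (t j)) ^ m ∣ restrictLine (u • P o) (u • y) f := by
    refine Fintype.prod_dvd_of_coprime
      (fun j k hjk => (Polynomial.pairwise_coprime_X_sub_C htinj hjk).pow) fun j => ?_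
    refine pow_dvd_restrictLine ?_
    rw [smul_comm (t j) u, ← smul_add, ← ht j, smul_smul]
    exact hf j _ (mul_ne_zero hu0 (hγ j))
  have hzero : restrictLine (u • P o) (u • y) f = 0 := by
    refine Polynomial.eq_zero_of_dvd_of_natDegree_lt hdvd ?_
    refine lt_of_le_of_lt (natDegree_restrictLine_le _ _ _) ?_
    rw [Polynomial.natDegree_prod_of_monic _ _
      fun j _ => (Polynomial.monic_X_sub_C (t j)).pow m]
    simpa [mul_comm] using hd
  have := eval_restrictLine (u • P o) (u • y) f u⁻¹
  rw [hzero, inv_smul_smul₀ hu0, add_comm] at this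
  simpa using this.symm

end MvPolynomial

/-- Lines of the projective plane, no three of which are concurrent, together with a choice of
pairwise intersection points. -/
structure StarConfiguration {s : ℕ} {K : Type*} [Field K] (L : Fin s → MvPolynomial (Fin 3) K)
    (Q : Fin s → Fin s → (Fin 3 → K)) : Prop where
  isHomogeneous : ∀ j, (L j).IsHomogeneous 1
  ne_zero : ∀ j, L j ≠ 0
  ne_smul : ∀ i j, i ≠ j → ∀ c : K, L i ≠ c • L j
  not_concurrent : ∀ i j k : Fin s, i ≠ j → i ≠ k → j ≠ k → ∀ x : Fin 3 → K, x ≠ 0 →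
    ¬ (eval x (L i) = 0 ∧ eval x (L j) = 0 ∧ eval x (L k) = 0)
  point : ∀ i j, i ≠ j → Q i j ≠ 0 ∧ eval (Q i j) (L i) = 0 ∧ eval (Q i j) (L j) = 0

namespace StarConfiguration

variable {s : ℕ} {K : Type*} [Field K] {L : Fin s → MvPolynomial (Fin 3) K}
  {Q : Fin s → Fin s → (Fin 3 → K)}

theorem prod_eq_mul (L : Fin s → MvPolynomial (Fin 3) K) {i j : Fin s} (hij : i ≠ j) :
    ∏ k, L k = L i * L j * ∏ k ∈ (Finset.univ.erase i).erase j, L k := by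
  rw [mul_assoc, Finset.mul_prod_erase _ _ (by simp [hij.symm]),
    Finset.mul_prod_erase _ _ (Finset.mem_univ i)]

theorem totalDegree_prod (h : StarConfiguration L Q) (t : Finset (Fin s)) :
    (∏ k ∈ t, L k).totalDegree = t.card := by
  have := IsHomogeneous.prod t L (fun _ => 1) fun k _ => h.isHomogeneous k
  simpa using this.totalDegree (Finset.prod_ne_zero_iff.mpr fun k _ => h.ne_zero k)

theorem orderAt_prod_le (h : StarConfiguration L Q) {i j : Fin s} (hij : i ≠ j) {c : K}
    (hc : c ≠ 0) : orderAt (c • Q i j) (∏ k, L k) ≤ 2 := by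
  rw [prod_eq_mul L hij, orderAt_mul, orderAt_mul]
  have hrest : orderAt (c • Q i j) (∏ k ∈ (Finset.univ.erase i).erase j, L k) = 0 := by
    refine orderAt_eq_zero ?_
    rw [map_prod, Finset.prod_ne_zero_iff]
    intro k hk h0
    simp only [Finset.mem_erase, Finset.mem_univ, and_true] at hk
    rw [(h.isHomogeneous k).eval_smul, mul_eq_zero, or_iff_right (pow_ne_zero _ hc)] at h0
    obtain ⟨hq0, hqi, hqj⟩ := h.point i j hij
    exact h.not_concurrent i j k hij hk.2.symm hk.1.symm _ hq0 ⟨hqi, hqj, h0⟩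
  rw [hrest, add_zero, ← one_add_one_eq_two]
  exact add_le_add ((h.isHomogeneous i).orderAt_le_one (h.ne_zero i) _)
    ((h.isHomogeneous j).orderAt_le_one (h.ne_zero j) _)

theorem isRelPrime (h : StarConfiguration L Q) {i j : Fin s} (hij : i ≠ j) :
    IsRelPrime (L i) (L j) := by
  refine ((h.isHomogeneous i).irreducible_of_one (h.ne_zero i)).isRelPrime_iff_not_dvd.mpr ?_
  rintro ⟨g, hg⟩
  have hg0 : g ≠ 0 := by
    rintro rfl
    exact h.ne_zero j (by simpa using hg)
  have hdeg := congrArg totalDegree hg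
  rw [totalDegree_mul_of_isDomain (h.ne_zero i) hg0, (h.isHomogeneous i).totalDegree (h.ne_zero i),
    (h.isHomogeneous j).totalDegree (h.ne_zero j)] at hdeg
  rw [totalDegree_eq_zero_iff_eq_C.mp (by omega : g.totalDegree = 0), mul_comm, ← smul_eq_C_mul]
    at hg
  exact h.ne_smul j i hij.symm _ hg

theorem dvd_of_totalDegree_lt [IsAlgClosed K] (h : StarConfiguration L Q)
    {f : MvPolynomial (Fin 3) K} {m : ℕ} (hm : 1 ≤ m) (hs : 2 ≤ s)
    (hf : ∀ i j, i ≠ j → ∀ c : K, c ≠ 0 → (m : ℕ∞) ≤ orderAt (c • Q i j) f)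
    (hd : f.totalDegree < m * (s - 1)) (i : Fin s) : L i ∣ f := by
  have hcard : Fintype.card {j // j ≠ i} = s - 1 := by simp
  have : Nonempty {j // j ≠ i} := Fintype.card_pos_iff.mp (by omega)
  refine IsHomogeneous.dvd_of_totalDegree_lt (h.isHomogeneous i) (h.ne_zero i)
    (fun j : {j // j ≠ i} => Q i j) (fun j => (h.point i j j.2.symm).1)
    (fun j => (h.point i j j.2.symm).2.1) ?_ hm (fun j => hf i j j.2.symm) (by rwa [hcard])
  intro j k hjk c hc
  obtain ⟨hj0, hji, hjj⟩ := h.point i j j.2.symm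
  refine h.not_concurrent i j k j.2.symm k.2.symm (fun e => hjk (Subtype.ext e)) _ hj0
    ⟨hji, hjj, ?_⟩
  rw [show Q i j = c • Q i k from hc, (h.isHomogeneous k).eval_smul, (h.point i k k.2.symm).2.2,
    mul_zero]

theorem exists_quotient [IsAlgClosed K] (h : StarConfiguration L Q)
    {f : MvPolynomial (Fin 3) K} (hf0 : f ≠ 0) {m : ℕ} (hm : 1 ≤ m) (hs : 2 ≤ s)
    (hf : ∀ i j, i ≠ j → ∀ c : K, c ≠ 0 → (m : ℕ∞) ≤ orderAt (c • Q i j) f)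
    (hd : f.totalDegree < m * (s - 1)) :
    ∃ g ≠ 0, f.totalDegree = s + g.totalDegree ∧
      ∀ i j, i ≠ j → ∀ c : K, c ≠ 0 → ((m - 2 : ℕ) : ℕ∞) ≤ orderAt (c • Q i j) g := by
  obtain ⟨g, rfl⟩ : ∏ k, L k ∣ f := Fintype.prod_dvd_of_isRelPrime
    (fun i j hij => h.isRelPrime hij) (h.dvd_of_totalDegree_lt hm hs hf hd)
  refine ⟨g, right_ne_zero_of_mul hf0, ?_, fun i j hij c hc => ?_⟩
  · rw [totalDegree_mul_of_isDomain (left_ne_zero_of_mul hf0) (right_ne_zero_of_mul hf0),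
      h.totalDegree_prod, Finset.card_univ, Fintype.card_fin]
  · have hle := hf i j hij c hc
    rw [orderAt_mul, add_comm] at hle
    rw [ENat.natCast_sub, tsub_le_iff_right]
    exact hle.trans (add_le_add le_rfl (h.orderAt_prod_le hij hc))

theorem le_totalDegree [IsAlgClosed K] (h : StarConfiguration L Q) (hs : 2 ≤ s) (m : ℕ) :
    ∀ f : MvPolynomial (Fin 3) K, f ≠ 0 →
      (∀ i j, i ≠ j → ∀ c : K, c ≠ 0 → (m : ℕ∞) ≤ orderAt (c • Q i j) f) →
      (Even m → m * s ≤ 2 * f.totalDegree) ∧ (Odd m → (m + 1) * s ≤ 2 * f.totalDegree + 2) := by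
  induction m using Nat.strong_induction_on with
  | _ m ih =>
    intro f hf0 hf
    obtain ⟨r, rfl⟩ := Nat.exists_eq_add_of_le' hs
    constructor
    · rintro ⟨k, rfl⟩
      rcases k with - | k
      · simp
      by_contra! hlt
      obtain ⟨g, hg0, hdeg, hg⟩ := h.exists_quotient hf0 (by omega) hs hf (by
        rw [Nat.add_sub_assoc (by omega)]
        nlinarith [Nat.zero_le (k * r)])
      have := (ih _ (by omega) g hg0 hg).1 ⟨k, by omega⟩
      rw [show k + 1 + (k + 1) - 2 = k + k by omega] at this
      nlinarith
    · rintro ⟨k, rfl⟩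
      by_contra! hlt
      obtain ⟨g, hg0, hdeg, hg⟩ := h.exists_quotient hf0 (by omega) hs hf (by
        rw [Nat.add_sub_assoc (by omega)]
        nlinarith [Nat.zero_le (k * r)])
      rcases k with - | k
      · omega
      have := (ih _ (by omega) g hg0 hg).2 ⟨k, by omega⟩
      rw [show 2 * (k + 1) + 1 - 2 = 2 * k + 1 by omega] at this
      nlinarith

theorem mem_projPointIdeal (h : StarConfiguration L Q) {i j : Fin s} (hij : i ≠ j) :
    L i ∈ projPointIdeal K (Q i j) ∧ L j ∈ projPointIdeal K (Q i j) :=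
  ⟨Ideal.subset_span ⟨⟨1, h.isHomogeneous i⟩, (h.point i j hij).2.1⟩,
    Ideal.subset_span ⟨⟨1, h.isHomogeneous j⟩, (h.point i j hij).2.2⟩⟩

theorem prod_pow_mem (h : StarConfiguration L Q) {i j : Fin s} (hij : i ≠ j) (k : ℕ) :
    (∏ l, L l) ^ k ∈ projPointIdeal K (Q i j) ^ (2 * k) := by
  obtain ⟨hi, hj⟩ := h.mem_projPointIdeal hij
  rw [pow_mul]
  refine Ideal.pow_mem_pow ?_ k
  rw [prod_eq_mul L hij, sq]
  exact Ideal.mul_mem_right _ _ (Ideal.mul_mem_mul hi hj)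

theorem prod_pow_mul_prod_erase_mem (h : StarConfiguration L Q) {o i j : Fin s} (hij : i ≠ j)
    (hj : j ≠ o) (k : ℕ) :
    (∏ l, L l) ^ k * ∏ l ∈ Finset.univ.erase o, L l ∈ projPointIdeal K (Q i j) ^ (2 * k + 1) := by
  rw [pow_succ]
  refine Ideal.mul_mem_mul (h.prod_pow_mem hij k) ?_
  exact Ideal.mem_of_dvd _ (Finset.dvd_prod_of_mem _ (by simp [hj]))
    (h.mem_projPointIdeal hij).2

theorem prod_ne_zero (h : StarConfiguration L Q) (t : Finset (Fin s)) : ∏ l ∈ t, L l ≠ 0 :=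
  Finset.prod_ne_zero_iff.mpr fun l _ => h.ne_zero l

theorem totalDegree_prod_pow (h : StarConfiguration L Q) (k : ℕ) :
    ((∏ l, L l) ^ k).totalDegree = k * s := by
  induction k with
  | zero => simp
  | succ k ih =>
    rw [pow_succ, totalDegree_mul_of_isDomain (pow_ne_zero _ (h.prod_ne_zero _))
      (h.prod_ne_zero _), ih, h.totalDegree_prod, Finset.card_univ, Fintype.card_fin, add_mul,
      one_mul]

end StarConfiguration

theorem alphaDeg_eq {σ K : Type*} [Field K] {I : Ideal (MvPolynomial σ K)} {d : ℕ}
    {f : MvPolynomial σ K} (hf : f ∈ I) (hf0 : f ≠ 0) (hd : f.totalDegree = d)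
    (hle : ∀ g ∈ I, g ≠ 0 → d ≤ g.totalDegree) : alphaDeg I = d := by
  refine le_antisymm (Nat.sInf_le ⟨f, hf, hf0, hd⟩) (le_csInf ⟨d, f, hf, hf0, hd⟩ ?_)
  rintro _ ⟨g, hg, hg0, rfl⟩
  exact hle g hg hg0

/-- let `L_1, …, L_s` (`s ≥ 2`) be distinct lines of `ℙ²`, no three of them
concurrent, with pairwise intersection points `q i j` (`i ≠ j`), and let `I` be the radical
ideal of these `C(s,2)` points. Then `α(I^{(m)}) = ms/2` for even `m ≥ 1` and
`α(I^{(m)}) = (m+1)s/2 − 1` for odd `m ≥ 1`. -/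
theorem stmt_19 {K : Type*} [Field K] [IsAlgClosed K]
    (s : ℕ) (hs : 2 ≤ s)
    (L : Fin s → MvPolynomial (Fin 3) K)
    (hLhom : ∀ j, (L j).IsHomogeneous 1) (hL0 : ∀ j, L j ≠ 0)
    (hLdist : ∀ i j, i ≠ j → ∀ c : K, L i ≠ c • L j)
    (hno3 : ∀ i j k : Fin s, i ≠ j → i ≠ k → j ≠ k →
      ∀ x : Fin 3 → K, x ≠ 0 →
        ¬ (MvPolynomial.eval x (L i) = 0 ∧ MvPolynomial.eval x (L j) = 0 ∧
            MvPolynomial.eval x (L k) = 0))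
    (q : Fin s → Fin s → (Fin 3 → K))
    (hq : ∀ i j, i ≠ j → q i j ≠ 0 ∧
      MvPolynomial.eval (q i j) (L i) = 0 ∧ MvPolynomial.eval (q i j) (L j) = 0) :
    ∀ m : ℕ, 1 ≤ m →
      (Even m →
        2 * alphaDeg (⨅ i, ⨅ j, ⨅ (_ : i < j), (projPointIdeal K (q i j)) ^ m) = m * s) ∧
      (Odd m →
        2 * alphaDeg (⨅ i, ⨅ j, ⨅ (_ : i < j), (projPointIdeal K (q i j)) ^ m)
          = (m + 1) * s - 2) := by
  intro m _
  have h : StarConfiguration L q := ⟨hLhom, hL0, hLdist, hno3, hq⟩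
  have h' : StarConfiguration L (fun i j => q (min i j) (max i j)) := by
    refine ⟨hLhom, hL0, hLdist, hno3, fun i j hij => ?_⟩
    rcases hij.lt_or_gt with hlt | hlt
    · simpa [min_eq_left hlt.le, max_eq_right hlt.le] using hq i j hij
    · simpa [min_eq_right hlt.le, max_eq_left hlt.le, and_comm] using hq j i hij.symm
  have hlow : ∀ g ∈ ⨅ i, ⨅ j, ⨅ (_ : i < j), (projPointIdeal K (q i j)) ^ m, g ≠ 0 →
      (Even m → m * s ≤ 2 * g.totalDegree) ∧
        (Odd m → (m + 1) * s ≤ 2 * g.totalDegree + 2) := by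
    intro g hg hg0
    simp only [Ideal.mem_iInf] at hg
    exact h'.le_totalDegree hs m g hg0 fun i j hij c _ =>
      le_orderAt_of_mem_projPointIdeal_pow (hg _ _ (min_lt_max.mpr hij)) c
  constructor
  · intro hm
    obtain ⟨k, rfl⟩ := even_iff_exists_two_mul.mp hm
    rw [alphaDeg_eq (f := (∏ l, L l) ^ k) (d := k * s) ?_ (pow_ne_zero _ (h.prod_ne_zero _))
      (h.totalDegree_prod_pow k), mul_assoc]
    · intro g hg hg0
      have := (hlow g hg hg0).1 hm
      rw [mul_assoc] at this
      omega
    · simp only [Ideal.mem_iInf]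
      exact fun i j hij => h.prod_pow_mem hij.ne k
  · intro hm
    obtain ⟨k, rfl⟩ := hm
    let o : Fin s := ⟨0, by omega⟩
    have hsplit : (2 * k + 1 + 1) * s = 2 * (k * s) + 2 * s := by ring
    rw [alphaDeg_eq (f := (∏ l, L l) ^ k * ∏ l ∈ Finset.univ.erase o, L l)
      (d := k * s + (s - 1)) ?_
      (mul_ne_zero (pow_ne_zero _ (h.prod_ne_zero _)) (h.prod_ne_zero _)), hsplit]
    · omega
    · rw [totalDegree_mul_of_isDomain (pow_ne_zero _ (h.prod_ne_zero _)) (h.prod_ne_zero _),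
        h.totalDegree_prod_pow, h.totalDegree_prod, Finset.card_erase_of_mem (Finset.mem_univ _),
        Finset.card_univ, Fintype.card_fin]
    · intro g hg hg0
      have := (hlow g hg hg0).2 ⟨k, rfl⟩
      omega
    · simp only [Ideal.mem_iInf]
      refine fun i j hij => h.prod_pow_mul_prod_erase_mem hij.ne ?_ k
      rintro rfl
      exact absurd hij (Nat.not_lt_zero _)
end
end
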